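/- arXiv:1805.08290 — 9 statements merged into one kernel-verified Lean document; each statement's English description precedes it below -/
import Mathlib

section
/- Let k be a field and Z ∈ k. The subspace {((φ₁,I₁),(φ₂,I₂)) ∈ k² × k² : φ₂ − φ₁ = Z·I₁ and I₁ = I₂} (the behavior of a circuit element of impedance Z) is a Lagrangian subspace of k² × k² with respect to the form Ω(((φ,I),(φ',I')),((ψ,J),(ψ',J'))) = −ω((φ,I),(ψ,J)) + ω((φ',I'),(ψ',J')), i.e. Ω vanishes identically on this subspace and the subspace is 2-dimensional. -/
open Module

/-- The standard symplectic form on `k²`: `ω((φ,I),(φ',I')) = φ·I' − φ'·I`. -/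
def sympForm (k : Type*) [Field k] : (k × k) → (k × k) → k :=
  fun p q => p.1 * q.2 - q.1 * p.2

/-- The state transformation `(φ, I) ↦ (φ + Z·I, I)` across a circuit element of impedance `Z`. -/
def impedanceMap {k : Type*} [Field k] (Z : k) : (k × k) →ₗ[k] (k × k) :=
  (LinearMap.fst k k k + Z • LinearMap.snd k k k).prod (LinearMap.snd k k k)

theorem impedanceMap_apply {k : Type*} [Field k] (Z : k) (p : k × k) :
    impedanceMap Z p = (p.1 + Z * p.2, p.2) := rfl

theorem sympForm_impedanceMap {k : Type*} [Field k] (Z : k) (p q : k × k) :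
    sympForm k (impedanceMap Z p) (impedanceMap Z q) = sympForm k p q := by
  simp only [sympForm, impedanceMap_apply]
  ring

theorem finrank_graph {k V W : Type*} [Field k] [AddCommGroup V] [Module k V]
    [AddCommGroup W] [Module k W] (f : V →ₗ[k] W) : finrank k f.graph = finrank k V := by
  rw [LinearMap.graph_eq_range_prod]
  exact LinearMap.finrank_range_of_inj fun _ _ h => congrArg Prod.fst h

/-- The behavior `{((φ₁,I₁),(φ₂,I₂)) : φ₂ − φ₁ = Z·I₁, I₁ = I₂}` of a
circuit element of impedance `Z` is a Lagrangian subspace of `k² × k²` for the form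
`Ω(x,y) = −ω(x₁,y₁) + ω(x₂,y₂)`: the form vanishes on it and it is 2-dimensional. -/
theorem impedance_behavior_lagrangian (k : Type*) [Field k] (Z : k) :
    ∃ L : Submodule k ((k × k) × (k × k)),
      (L : Set ((k × k) × (k × k))) =
        {p | p.2.1 - p.1.1 = Z * p.1.2 ∧ p.1.2 = p.2.2} ∧
      (∀ x ∈ L, ∀ y ∈ L, -sympForm k x.1 y.1 + sympForm k x.2 y.2 = 0) ∧
      finrank k L = 2 := by
  refine ⟨(impedanceMap Z).graph, ?_, ?_, ?_⟩
  · ext ⟨⟨a, b⟩, c, d⟩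
    simp only [SetLike.mem_coe, LinearMap.mem_graph_iff, impedanceMap_apply, Prod.mk.injEq,
      Set.mem_ofPred_eq, sub_eq_iff_eq_add', eq_comm (a := d)]
  · intro x hx y hy
    rw [LinearMap.mem_graph_iff] at hx hy
    rw [hx, hy, sympForm_impedanceMap, neg_add_cancel]
  · rw [finrank_graph, finrank_prod, finrank_self]
end

section
/- Let k be a field and let U, V, W be finite-dimensional k-vector spaces equipped with alternating nondegenerate bilinear forms ω_U, ω_V, ω_W. Call a subset R ⊆ U × V a Lagrangian affine relation from U to V if R is (the carrier of) an affine subspace of U × V and either R is empty or the direction of R is a Lagrangian subspace of U × V with respect to the form Ω_{U,V}((u,v),(u',v')) = −ω_U(u,u') + ω_V(v,v') (i.e. Ω_{U,V} vanishes on the direction and the direction has dimension (dim U + dim V)/2). If R ⊆ U × V and S ⊆ V × W are Lagrangian affine relations, then the relation composite S∘R ⊆ U × W is a Lagrangian affine relation from U to W. -/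
open Module

/-- The relation composite of `R ⊆ U × V` and `S ⊆ V × W`. -/
def relComp {U V W : Type*} (R : Set (U × V)) (S : Set (V × W)) : Set (U × W) :=
  {p | ∃ v, (p.1, v) ∈ R ∧ (v, p.2) ∈ S}

/-- Rank-nullity for the restriction of a linear map to a submodule. -/
theorem Submodule.finrank_map_add_finrank_inf_ker {k E F : Type*} [Field k]
    [AddCommGroup E] [Module k E] [FiniteDimensional k E] [AddCommGroup F] [Module k F]
    (f : E →ₗ[k] F) (P : Submodule k E) :
    finrank k (P.map f) + finrank k (P ⊓ LinearMap.ker f : Submodule k E) = finrank k P := by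
  rw [← LinearMap.finrank_range_add_finrank_ker (f.domRestrict P), LinearMap.range_domRestrict,
    LinearMap.ker_domRestrict, ← Submodule.map_comap_subtype,
    LinearEquiv.finrank_eq (Submodule.equivSubtypeMap P _)]

/-- Mutually orthogonal subspaces for a nondegenerate alternating form have total dimension at most
that of the ambient space. -/
theorem finrank_add_finrank_le_of_orthogonal {k E : Type*} [Field k]
    [AddCommGroup E] [Module k E] [FiniteDimensional k E] (ω : E →ₗ[k] E →ₗ[k] k)
    (halt : ∀ x, ω x x = 0) (hnd : ∀ y, (∀ x, ω x y = 0) → y = 0)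
    (I J : Submodule k E) (h : ∀ x ∈ J, ∀ y ∈ I, ω x y = 0) :
    finrank k I + finrank k J ≤ finrank k E := by
  have hrefl : LinearMap.IsRefl ω := LinearMap.IsAlt.isRefl halt
  have hω : LinearMap.BilinForm.Nondegenerate ω :=
    hrefl.nondegenerate_iff_separatingRight.mpr hnd
  have hle : I ≤ LinearMap.BilinForm.orthogonal ω J := fun y hy x hx => h x hx y hy
  have h1 := Submodule.finrank_mono hle
  rw [LinearMap.BilinForm.finrank_orthogonal hω] at h1
  have h2 := J.finrank_le
  omega

/-- The composite of two linear relations, as a submodule. -/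
def Submodule.relComp {k U V W : Type*} [Field k]
    [AddCommGroup U] [Module k U] [AddCommGroup V] [Module k V] [AddCommGroup W] [Module k W]
    (L : Submodule k (U × V)) (M : Submodule k (V × W)) : Submodule k (U × W) where
  carrier := _root_.relComp (L : Set (U × V)) (M : Set (V × W))
  zero_mem' := ⟨0, L.zero_mem, M.zero_mem⟩
  add_mem' := by
    rintro x y ⟨v, h1, h2⟩ ⟨v', h1', h2'⟩
    exact ⟨v + v', L.add_mem h1 h1', M.add_mem h2 h2'⟩
  smul_mem' := by
    rintro c x ⟨v, h1, h2⟩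
    exact ⟨c • v, L.smul_mem c h1, M.smul_mem c h2⟩

theorem Submodule.mem_relComp {k U V W : Type*} [Field k]
    [AddCommGroup U] [Module k U] [AddCommGroup V] [Module k V] [AddCommGroup W] [Module k W]
    {L : Submodule k (U × V)} {M : Submodule k (V × W)} {p : U × W} :
    p ∈ L.relComp M ↔ ∃ v, (p.1, v) ∈ L ∧ (v, p.2) ∈ M :=
  Iff.rfl

/-- The composite of isotropic linear relations is isotropic. -/
theorem Submodule.relComp_isotropic {k U V W : Type*} [Field k]
    [AddCommGroup U] [Module k U] [AddCommGroup V] [Module k V] [AddCommGroup W] [Module k W]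
    {ωU : U →ₗ[k] U →ₗ[k] k} {ωV : V →ₗ[k] V →ₗ[k] k} {ωW : W →ₗ[k] W →ₗ[k] k}
    {L : Submodule k (U × V)} {M : Submodule k (V × W)}
    (hL : ∀ x ∈ L, ∀ y ∈ L, -ωU x.1 y.1 + ωV x.2 y.2 = 0)
    (hM : ∀ x ∈ M, ∀ y ∈ M, -ωV x.1 y.1 + ωW x.2 y.2 = 0) :
    ∀ x ∈ L.relComp M, ∀ y ∈ L.relComp M, -ωU x.1 y.1 + ωW x.2 y.2 = 0 := by
  rintro x ⟨v, h1, h2⟩ y ⟨v', h1', h2'⟩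
  linear_combination hL _ h1 _ h1' + hM _ h2 _ h2'

/-- An isotropic linear relation between symplectic vector spaces has at most half the dimension
of the product. -/
theorem two_mul_finrank_le_of_isotropic {k U W : Type*} [Field k]
    [AddCommGroup U] [Module k U] [FiniteDimensional k U]
    [AddCommGroup W] [Module k W] [FiniteDimensional k W]
    (ωU : U →ₗ[k] U →ₗ[k] k) (ωW : W →ₗ[k] W →ₗ[k] k)
    (hUalt : ∀ u : U, ωU u u = 0) (hUnd : ∀ v : U, (∀ u : U, ωU u v = 0) → v = 0)
    (hWalt : ∀ u : W, ωW u u = 0) (hWnd : ∀ v : W, (∀ u : W, ωW u v = 0) → v = 0)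
    (N : Submodule k (U × W)) (hN : ∀ x ∈ N, ∀ y ∈ N, -ωU x.1 y.1 + ωW x.2 y.2 = 0) :
    2 * finrank k N ≤ finrank k U + finrank k W := by
  let Ω : (U × W) →ₗ[k] (U × W) →ₗ[k] k :=
    -ωU.compl₁₂ (LinearMap.fst k U W) (LinearMap.fst k U W) +
      ωW.compl₁₂ (LinearMap.snd k U W) (LinearMap.snd k U W)
  have hΩ : ∀ x y, Ω x y = -ωU x.1 y.1 + ωW x.2 y.2 := fun _ _ => rfl
  have h := finrank_add_finrank_le_of_orthogonal Ω (fun x => by simp [hΩ, hUalt, hWalt])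
    (fun y hy => Prod.ext (hUnd _ fun u => by simpa [hΩ] using hy (u, 0))
      (hWnd _ fun w => by simpa [hΩ] using hy (0, w))) N N
    (fun x hx y hy => (hΩ x y).trans (hN x hx y hy))
  rw [Module.finrank_prod] at h
  omega

/-- Composing isotropic linear relations over a symplectic space `V` loses at most `dim V`
dimensions. -/
theorem Submodule.finrank_add_finrank_le_finrank_relComp {k U V W : Type*} [Field k]
    [AddCommGroup U] [Module k U] [FiniteDimensional k U]
    [AddCommGroup V] [Module k V] [FiniteDimensional k V]
    [AddCommGroup W] [Module k W] [FiniteDimensional k W]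
    {ωU : U →ₗ[k] U →ₗ[k] k} {ωV : V →ₗ[k] V →ₗ[k] k} {ωW : W →ₗ[k] W →ₗ[k] k}
    (hValt : ∀ u : V, ωV u u = 0) (hVnd : ∀ v : V, (∀ u : V, ωV u v = 0) → v = 0)
    {L : Submodule k (U × V)} {M : Submodule k (V × W)}
    (hL : ∀ x ∈ L, ∀ y ∈ L, -ωU x.1 y.1 + ωV x.2 y.2 = 0)
    (hM : ∀ x ∈ M, ∀ y ∈ M, -ωV x.1 y.1 + ωW x.2 y.2 = 0) :
    finrank k L + finrank k M ≤ finrank k (L.relComp M) + finrank k V := by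
  let f : ((U × V) × (V × W)) →ₗ[k] V :=
    LinearMap.snd k U V ∘ₗ LinearMap.fst k _ _ - LinearMap.fst k V W ∘ₗ LinearMap.snd k _ _
  let g : ((U × V) × (V × W)) →ₗ[k] U × W :=
    (LinearMap.fst k U V).prodMap (LinearMap.snd k V W)
  let h : ((U × V) × (V × W)) →ₗ[k] V := LinearMap.fst k V W ∘ₗ LinearMap.snd k _ _
  have hf : ∀ x, f x = x.1.2 - x.2.1 := fun _ => rfl
  have hg : ∀ x, g x = (x.1.1, x.2.2) := fun _ => rfl
  have hh : ∀ x, h x = x.2.1 := fun _ => rfl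
  set P := L.prod M
  set K := P ⊓ LinearMap.ker f
  set I := K ⊓ LinearMap.ker g
  have mem_I : ∀ x ∈ I, x.1 ∈ L ∧ x.2 ∈ M ∧ x.1.2 = x.2.1 ∧ x.1.1 = 0 ∧ x.2.2 = 0 := by
    rintro x ⟨⟨⟨h1, h2⟩, h3⟩, h4⟩
    rw [SetLike.mem_coe, LinearMap.mem_ker, hf, sub_eq_zero] at h3
    rw [SetLike.mem_coe, LinearMap.mem_ker, hg, Prod.mk_eq_zero] at h4
    exact ⟨h1, h2, h3, h4.1, h4.2⟩
  have hP : finrank k P = finrank k L + finrank k M := by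
    have hinj : Function.Injective (L.subtype.prodMap M.subtype) :=
      L.subtype_injective.prodMap M.subtype_injective
    rw [← Module.finrank_prod, ← LinearMap.finrank_range_of_inj hinj, LinearMap.range_prodMap,
      Submodule.range_subtype, Submodule.range_subtype]
  have e1 : finrank k (P.map f) + finrank k K = finrank k P := finrank_map_add_finrank_inf_ker f P
  have e2 : finrank k (K.map g) + finrank k I = finrank k K := finrank_map_add_finrank_inf_ker g K
  have e3 := finrank_map_add_finrank_inf_ker h I
  have hIh : I ⊓ LinearMap.ker h = ⊥ := by
    refine (Submodule.eq_bot_iff _).mpr fun x hx => ?_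
    obtain ⟨-, -, h3, h4, h5⟩ := mem_I x hx.1
    have h6 : x.2.1 = 0 := hx.2
    exact Prod.ext (Prod.ext h4 (h3.trans h6)) (Prod.ext h6 h5)
  rw [hIh, finrank_bot] at e3
  have hN : K.map g ≤ L.relComp M := by
    rintro _ ⟨x, ⟨⟨h1, h2⟩, h3⟩, rfl⟩
    rw [SetLike.mem_coe, LinearMap.mem_ker, hf, sub_eq_zero] at h3
    refine ⟨x.1.2, h1, ?_⟩
    rw [h3]
    exact h2
  have hNrank := Submodule.finrank_mono hN
  have horth := finrank_add_finrank_le_of_orthogonal ωV hValt hVnd (I.map h) (P.map f) (by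
    rintro _ ⟨x, ⟨hx1, hx2⟩, rfl⟩ _ ⟨y, hy, rfl⟩
    obtain ⟨h1, h2, h3, h4, h5⟩ := mem_I y hy
    have a := hL _ hx1 _ h1
    have b := hM _ hx2 _ h2
    rw [h4, h3, map_zero, neg_zero, zero_add] at a
    rw [h5, map_zero, add_zero, neg_eq_zero] at b
    rw [hf, hh, map_sub, LinearMap.sub_apply, a, b, sub_zero])
  omega

/-- The composite of affine relations through a common point is the affine relation through that
point whose direction is the composite of the directions. -/
theorem AffineSubspace.coe_mk'_relComp {k U V W : Type*} [Field k]
    [AddCommGroup U] [Module k U] [AddCommGroup V] [Module k V] [AddCommGroup W] [Module k W]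
    {A : AffineSubspace k (U × V)} {B : AffineSubspace k (V × W)} {p : U × W} {v : V}
    (hA : (p.1, v) ∈ A) (hB : (v, p.2) ∈ B) :
    (AffineSubspace.mk' p (A.direction.relComp B.direction) : Set (U × W)) =
      relComp (A : Set (U × V)) (B : Set (V × W)) := by
  ext q
  rw [SetLike.mem_coe, AffineSubspace.mem_mk', Submodule.mem_relComp]
  constructor
  · rintro ⟨v', h1, h2⟩
    refine ⟨v' + v, ?_, ?_⟩
    · simpa using AffineSubspace.vadd_mem_of_mem_direction h1 hA
    · simpa using AffineSubspace.vadd_mem_of_mem_direction h2 hB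
  · rintro ⟨v', h1, h2⟩
    exact ⟨v' - v, A.vsub_mem_direction h1 hA, B.vsub_mem_direction h2 hB⟩

/-- The relation composite of Lagrangian affine relations between
symplectic vector spaces is a Lagrangian affine relation. -/
theorem lagrangian_affine_relations_comp
    (k U V W : Type*) [Field k]
    [AddCommGroup U] [Module k U] [FiniteDimensional k U]
    [AddCommGroup V] [Module k V] [FiniteDimensional k V]
    [AddCommGroup W] [Module k W] [FiniteDimensional k W]
    (ωU : U →ₗ[k] U →ₗ[k] k) (ωV : V →ₗ[k] V →ₗ[k] k) (ωW : W →ₗ[k] W →ₗ[k] k)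
    (hUalt : ∀ u : U, ωU u u = 0) (hUnd : ∀ v : U, (∀ u : U, ωU u v = 0) → v = 0)
    (hValt : ∀ u : V, ωV u u = 0) (hVnd : ∀ v : V, (∀ u : V, ωV u v = 0) → v = 0)
    (hWalt : ∀ u : W, ωW u u = 0) (hWnd : ∀ v : W, (∀ u : W, ωW u v = 0) → v = 0)
    (R : Set (U × V)) (S : Set (V × W))
    (hR : ∃ A : AffineSubspace k (U × V), (A : Set (U × V)) = R ∧
      (R = ∅ ∨
        ((∀ x ∈ A.direction, ∀ y ∈ A.direction, -ωU x.1 y.1 + ωV x.2 y.2 = 0) ∧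
          2 * finrank k A.direction = finrank k U + finrank k V)))
    (hS : ∃ B : AffineSubspace k (V × W), (B : Set (V × W)) = S ∧
      (S = ∅ ∨
        ((∀ x ∈ B.direction, ∀ y ∈ B.direction, -ωV x.1 y.1 + ωW x.2 y.2 = 0) ∧
          2 * finrank k B.direction = finrank k V + finrank k W))) :
    ∃ C : AffineSubspace k (U × W), (C : Set (U × W)) = relComp R S ∧
      (relComp R S = ∅ ∨
        ((∀ x ∈ C.direction, ∀ y ∈ C.direction, -ωU x.1 y.1 + ωW x.2 y.2 = 0) ∧
          2 * finrank k C.direction = finrank k U + finrank k W)) := by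
  obtain ⟨A, rfl, hA⟩ := hR
  obtain ⟨B, rfl, hB⟩ := hS
  rcases (relComp (A : Set (U × V)) (B : Set (V × W))).eq_empty_or_nonempty with he | ⟨p, v, hpA, hpB⟩
  · exact ⟨⊥, by rw [he, AffineSubspace.bot_coe], Or.inl he⟩
  obtain ⟨hAiso, hAdim⟩ := hA.resolve_left (Set.nonempty_of_mem hpA).ne_empty
  obtain ⟨hBiso, hBdim⟩ := hB.resolve_left (Set.nonempty_of_mem hpB).ne_empty
  refine ⟨AffineSubspace.mk' p (A.direction.relComp B.direction),
    AffineSubspace.coe_mk'_relComp hpA hpB, Or.inr ?_⟩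
  rw [AffineSubspace.direction_mk']
  have hiso := Submodule.relComp_isotropic hAiso hBiso
  have hle := two_mul_finrank_le_of_isotropic ωU ωW hUalt hUnd hWalt hWnd _ hiso
  have hge := Submodule.finrank_add_finrank_le_finrank_relComp hValt hVnd hAiso hBiso
  exact ⟨hiso, by omega⟩
end

section
/- Let k be a field and V₀, I₀ ∈ k. The voltage-source set {((φ₁,I₁),(φ₂,I₂)) ∈ k² × k² : φ₂ − φ₁ = V₀ and I₁ = I₂} and the current-source set {((φ₁,I₁),(φ₂,I₂)) ∈ k² × k² : I₁ = I₂ = I₀} are each nonempty affine subspaces of k² × k² whose directions — respectively {((φ,I),(φ,I)) : φ, I ∈ k} and {((φ₁,0),(φ₂,0)) : φ₁, φ₂ ∈ k} — are Lagrangian subspaces of k² × k² with respect to the form Ω(((φ,I),(φ',I')),((ψ,J),(ψ',J'))) = −ω((φ,I),(ψ,J)) + ω((φ',I'),(ψ',J')). Hence both sets are Lagrangian affine relations from k² to itself. -/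
open Module

theorem two_mul_finrank_range_of_injective {k : Type*} [Field k]
    {f : (k × k) →ₗ[k] (k × k) × (k × k)} (hf : Function.Injective f) :
    2 * finrank k (LinearMap.range f) = finrank k ((k × k) × (k × k)) := by
  rw [LinearMap.finrank_range_of_inj hf]
  simp

/-- The diagonal embedding `(φ, I) ↦ ((φ, I), (φ, I))`. -/
def diagonalMap (k : Type*) [Field k] : (k × k) →ₗ[k] (k × k) × (k × k) :=
  LinearMap.prod LinearMap.id LinearMap.id

/-- The embedding of pairs of potentials `(φ₁, φ₂) ↦ ((φ₁, 0), (φ₂, 0))`. -/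
def potentialMap (k : Type*) [Field k] : (k × k) →ₗ[k] (k × k) × (k × k) :=
  LinearMap.prodMap (LinearMap.inl k k k) (LinearMap.inl k k k)

theorem mem_range_diagonalMap {k : Type*} [Field k] {p : (k × k) × (k × k)} :
    p ∈ LinearMap.range (diagonalMap k) ↔ p.1 = p.2 := by
  constructor
  · rintro ⟨x, rfl⟩
    rfl
  · intro h
    exact ⟨p.1, Prod.ext rfl h⟩

theorem mem_range_potentialMap {k : Type*} [Field k] {p : (k × k) × (k × k)} :
    p ∈ LinearMap.range (potentialMap k) ↔ p.1.2 = 0 ∧ p.2.2 = 0 := by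
  constructor
  · rintro ⟨x, rfl⟩
    exact ⟨rfl, rfl⟩
  · rintro ⟨h₁, h₂⟩
    exact ⟨(p.1.1, p.2.1), Prod.ext (Prod.ext rfl h₁.symm) (Prod.ext rfl h₂.symm)⟩

theorem diagonalMap_injective (k : Type*) [Field k] : Function.Injective (diagonalMap k) :=
  fun _ _ h => congrArg Prod.fst h

theorem potentialMap_injective (k : Type*) [Field k] : Function.Injective (potentialMap k) :=
  fun _ _ h => Prod.ext (congrArg (fun p => p.1.1) h) (congrArg (fun p => p.2.1) h)

/-- The behaviors of a voltage source of voltage `V₀` and a current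
source of current `I₀` are nonempty affine subspaces of `k² × k²` whose directions are
the indicated Lagrangian subspaces; hence they are Lagrangian affine relations. -/
theorem sources_lagrangian_affine (k : Type*) [Field k] (V₀ I₀ : k) :
    -- voltage source: φ₂ − φ₁ = V₀ and I₁ = I₂
    (∃ A : AffineSubspace k ((k × k) × (k × k)),
      (A : Set ((k × k) × (k × k))) = {p | p.2.1 - p.1.1 = V₀ ∧ p.1.2 = p.2.2} ∧
      ({p : (k × k) × (k × k) | p.2.1 - p.1.1 = V₀ ∧ p.1.2 = p.2.2}).Nonempty ∧
      (A.direction : Set ((k × k) × (k × k))) = {p | p.1 = p.2} ∧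
      (∀ x ∈ A.direction, ∀ y ∈ A.direction,
        -sympForm k x.1 y.1 + sympForm k x.2 y.2 = 0) ∧
      2 * finrank k A.direction = finrank k ((k × k) × (k × k))) ∧
    -- current source: I₁ = I₂ = I₀
    (∃ A : AffineSubspace k ((k × k) × (k × k)),
      (A : Set ((k × k) × (k × k))) = {p | p.1.2 = p.2.2 ∧ p.1.2 = I₀} ∧
      ({p : (k × k) × (k × k) | p.1.2 = p.2.2 ∧ p.1.2 = I₀}).Nonempty ∧
      (A.direction : Set ((k × k) × (k × k))) = {p | p.1.2 = 0 ∧ p.2.2 = 0} ∧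
      (∀ x ∈ A.direction, ∀ y ∈ A.direction,
        -sympForm k x.1 y.1 + sympForm k x.2 y.2 = 0) ∧
      2 * finrank k A.direction = finrank k ((k × k) × (k × k))) := by
  refine ⟨⟨AffineSubspace.mk' ((0, 0), (V₀, 0)) (LinearMap.range (diagonalMap k)),
      ?_, ⟨((0, 0), (V₀, 0)), by simp⟩, ?_⟩,
    ⟨AffineSubspace.mk' ((0, I₀), (0, I₀)) (LinearMap.range (potentialMap k)),
      ?_, ⟨((0, I₀), (0, I₀)), by simp⟩, ?_⟩⟩
  · ext ⟨⟨a, b⟩, ⟨c, d⟩⟩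
    simp only [SetLike.mem_coe, AffineSubspace.mem_mk', mem_range_diagonalMap, vsub_eq_sub,
      Prod.mk_sub_mk, Prod.mk.injEq, sub_zero, Set.mem_ofPred_eq]
    grind
  · rw [AffineSubspace.direction_mk']
    refine ⟨Set.ext fun p => mem_range_diagonalMap, fun x hx y hy => ?_,
      two_mul_finrank_range_of_injective (diagonalMap_injective k)⟩
    rw [mem_range_diagonalMap] at hx hy
    rw [hx, hy, neg_add_cancel]
  · ext ⟨⟨a, b⟩, ⟨c, d⟩⟩
    simp only [SetLike.mem_coe, AffineSubspace.mem_mk', mem_range_potentialMap, vsub_eq_sub,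
      Prod.mk_sub_mk, Set.mem_ofPred_eq]
    grind
  · rw [AffineSubspace.direction_mk']
    refine ⟨Set.ext fun p => mem_range_potentialMap, fun x hx y hy => ?_,
      two_mul_finrank_range_of_injective (potentialMap_injective k)⟩
    rw [mem_range_potentialMap] at hx hy
    simp [sympForm, hx, hy]
end

section
/- Let k be a field. Define three relations: α ⊆ k⁴ × k⁸ consisting of all pairs ((V₁,I₁,V₂,I₂),(φ₁,i₁,φ₂,i₂,φ₃,i₃,φ₄,i₄)) with V₁ = φ₂ − φ₁, I₁ = i₁, I₁ = −i₂, V₂ = φ₄ − φ₃, I₂ = i₃ and I₂ = −i₄; β ⊆ k⁸ × k⁴ consisting of all pairs ((φ₁,i₁,φ₂,i₂,φ₃,i₃,φ₄,i₄),(φ₅,i₅,φ₆,i₆)) with φ₁ = φ₅, i₁ = i₅, φ₄ = φ₆, i₄ = i₆, φ₂ = φ₃ and i₂ + i₃ = 0; and γ ⊆ k⁴ × k² consisting of all pairs ((φ₅,i₅,φ₆,i₆),(V,I)) with V = φ₆ − φ₅, I = i₅ and I = −i₆. Then the relation composite γ∘β∘α equals {((V₁,I₁,V₂,I₂),(V,I))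 : V = V₁ + V₂ and I = I₁ = I₂}. -/
variable (k : Type*) [Field k]

/-- `α ⊆ k⁴ × k⁸`: translating two effort–flow pairs into potential–current pairs. -/
def alpha10 : Set ((k × k × k × k) × (k × k × k × k × k × k × k × k)) :=
  fun x => match x with
  | ((V₁, I₁, V₂, I₂), (φ₁, i₁, φ₂, i₂, φ₃, i₃, φ₄, i₄)) =>
      V₁ = φ₂ - φ₁ ∧ I₁ = i₁ ∧ I₁ = -i₂ ∧ V₂ = φ₄ - φ₃ ∧ I₂ = i₃ ∧ I₂ = -i₄

/-- `β ⊆ k⁸ × k⁴`: the potential–current behavior of a 1-junction made of wires. -/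
def beta10 : Set ((k × k × k × k × k × k × k × k) × (k × k × k × k)) :=
  fun x => match x with
  | ((φ₁, i₁, φ₂, i₂, φ₃, i₃, φ₄, i₄), (φ₅, i₅, φ₆, i₆)) =>
      φ₁ = φ₅ ∧ i₁ = i₅ ∧ φ₄ = φ₆ ∧ i₄ = i₆ ∧ φ₂ = φ₃ ∧ i₂ + i₃ = 0

/-- `γ ⊆ k⁴ × k²`: translating a potential–current pair back into an effort–flow pair. -/
def gamma10 : Set ((k × k × k × k) × (k × k)) :=
  fun x => match x with
  | ((φ₅, i₅, φ₆, i₆), (V, I)) => V = φ₆ - φ₅ ∧ I = i₅ ∧ I = -i₆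

/-- The composite `γ ∘ β ∘ α` is the effort–flow behavior of the
1-junction: efforts add while flows are equal. -/
theorem oneJunction_effort_flow :
    relComp (relComp (alpha10 k) (beta10 k)) (gamma10 k) =
      (fun x => match x with
        | ((V₁, I₁, V₂, I₂), (V, I)) => V = V₁ + V₂ ∧ I = I₁ ∧ I = I₂ :
        Set ((k × k × k × k) × (k × k))) := by
  ext ⟨⟨V₁, I₁, V₂, I₂⟩, V, I⟩
  constructor
  · rintro ⟨⟨φ₅, i₅, φ₆, i₆⟩, ⟨⟨φ₁, i₁, φ₂, i₂, φ₃, i₃, φ₄, i₄⟩,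
      ⟨hV₁, hI₁, -, hV₂, -, hI₂⟩, ⟨h₁, hi₁, h₄, hi₄, h₂₃, -⟩⟩, ⟨hV, hI, hI'⟩⟩
    refine ⟨?_, ?_, ?_⟩
    · rw [hV, hV₁, hV₂, ← h₁, ← h₄, h₂₃]
      ring
    · rw [hI, hI₁, hi₁]
    · rw [hI', hI₂, hi₄]
  · rintro ⟨rfl, rfl, rfl⟩
    exact ⟨(0, I, V₁ + V₂, -I),
      ⟨(0, I, V₁, -I, V₁, I, V₁ + V₂, -I),
        ⟨(sub_zero _).symm, rfl, (neg_neg _).symm, (add_sub_cancel_left _ _).symm, rfl,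
          (neg_neg _).symm⟩,
        ⟨rfl, rfl, rfl, rfl, rfl, neg_add_cancel _⟩⟩,
      ⟨(sub_zero _).symm, rfl, (neg_neg _).symm⟩⟩
end

section
/- Let k be a field, and let μ = Δ†⊕+ ⊆ (k²×k²) × k² and δ = +†⊕Δ ⊆ k² × (k²×k²) be the relations as defined. Then the bimonoid compatibility law holds as an equality of relations: the composite δ∘μ ⊆ (k²×k²) × (k²×k²) equals the set {((x₁,x₂),(z₁,z₂)) : there exist a, b, c, d ∈ k² with (x₁,(a,b)) ∈ δ, (x₂,(c,d)) ∈ δ, ((a,c),z₁) ∈ μ and ((b,d),z₂) ∈ μ}. (This is the bimonoid law δ∘μ = (μ⊗μ)∘(1⊗σ⊗1)∘(δ⊗δ), where σ swaps the two middle factors.) -/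
variable (k : Type*) [Field k]

/-- `μ = Δ†⊕+ ⊆ (k²×k²) × k²`. -/
def muRel : Set (((k × k) × (k × k)) × (k × k)) :=
  {x | x.1.1.1 = x.2.1 ∧ x.1.2.1 = x.2.1 ∧ x.1.1.2 + x.1.2.2 = x.2.2}

/-- `δ = +†⊕Δ ⊆ k² × (k²×k²)`. -/
def deltaRel : Set ((k × k) × ((k × k) × (k × k))) :=
  {x | x.1.1 = x.2.1.1 + x.2.2.1 ∧ x.1.2 = x.2.1.2 ∧ x.1.2 = x.2.2.2}

/-- The bimonoid compatibility law
`δ∘μ = (μ⊗μ)∘(1⊗σ⊗1)∘(δ⊗δ)` holds as an equality of relations. -/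
theorem bimonoid_law :
    relComp (muRel k) (deltaRel k) =
      {x : ((k × k) × (k × k)) × ((k × k) × (k × k)) |
        ∃ a b c d : k × k,
          (x.1.1, (a, b)) ∈ deltaRel k ∧ (x.1.2, (c, d)) ∈ deltaRel k ∧
          ((a, c), x.2.1) ∈ muRel k ∧ ((b, d), x.2.2) ∈ muRel k} := by
  ext ⟨⟨⟨E₁, F₁⟩, ⟨E₂, F₂⟩⟩, ⟨⟨G₁, H₁⟩, ⟨G₂, H₂⟩⟩⟩
  simp only [relComp, muRel, deltaRel, Set.mem_ofPred_eq]
  constructor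
  · rintro ⟨⟨E, F⟩, ⟨rfl, rfl, rfl⟩, hE, hH₁, hH₂⟩
    exact ⟨(G₁, F₁), (G₂, F₁), (G₁, F₂), (G₂, F₂),
      ⟨hE, rfl, rfl⟩, ⟨hE, rfl, rfl⟩, ⟨rfl, rfl, hH₁⟩, ⟨rfl, rfl, hH₂⟩⟩
  · rintro ⟨⟨a₁, a₂⟩, ⟨b₁, b₂⟩, ⟨c₁, c₂⟩, ⟨d₁, d₂⟩,
      ⟨rfl, rfl, rfl⟩, ⟨rfl, rfl, rfl⟩, ⟨rfl, rfl, rfl⟩, ⟨rfl, rfl, rfl⟩⟩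
    exact ⟨(_, _), ⟨rfl, rfl, rfl⟩, rfl, rfl, rfl⟩
end

section
/- Let k be a field, and let μ' = +⊕Δ† ⊆ (k²×k²) × k² and δ' = +†⊕Δ ⊆ k² × (k²×k²) be the relations as defined. Then: (i) (special law) the relation composite μ'∘δ' equals the identity relation {(x,x) : x ∈ k²}; (ii) (Frobenius law) the relation composite δ'∘μ' ⊆ (k²×k²) × (k²×k²) equals the set {((x₁,x₂),(z₁,z₂)) : there exist a, b ∈ k² with (x₁,(a,b)) ∈ δ', ((b,x₂),z₂) ∈ μ' and z₁ = a}. (This is the law δ'∘μ' = (1⊗μ')∘(δ'⊗1).) -/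
variable (k : Type*) [Field k]

/-- `μ' = +⊕Δ† ⊆ (k²×k²) × k²`: efforts add, flows are coduplicated. -/
def muRel' : Set (((k × k) × (k × k)) × (k × k)) :=
  {x | x.1.1.1 + x.1.2.1 = x.2.1 ∧ x.1.1.2 = x.2.2 ∧ x.1.2.2 = x.2.2}

/-- `δ' = +†⊕Δ ⊆ k² × (k²×k²)`: efforts coadd, flows are duplicated. -/
def deltaRel' : Set ((k × k) × ((k × k) × (k × k))) :=
  {x | x.1.1 = x.2.1.1 + x.2.2.1 ∧ x.1.2 = x.2.1.2 ∧ x.1.2 = x.2.2.2}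

/-- The special law `μ'∘δ' = 1` and the Frobenius law
`δ'∘μ' = (1⊗μ')∘(δ'⊗1)` hold as equalities of relations. -/
theorem special_and_frobenius_laws :
    relComp (deltaRel' k) (muRel' k) = {p : (k × k) × (k × k) | p.1 = p.2} ∧
    relComp (muRel' k) (deltaRel' k) =
      {x : ((k × k) × (k × k)) × ((k × k) × (k × k)) |
        ∃ a b : k × k,
          (x.1.1, (a, b)) ∈ deltaRel' k ∧ ((b, x.1.2), x.2.2) ∈ muRel' k ∧
          x.2.1 = a} := by
  constructor
  · ext ⟨⟨e, f⟩, ⟨e', f'⟩⟩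
    simp only [relComp, muRel', deltaRel', Set.mem_ofPred_eq, Prod.mk.injEq]
    constructor
    · rintro ⟨v, ⟨h₁, h₂, -⟩, h₃, h₄, -⟩
      exact ⟨h₁.trans h₃, h₂.trans h₄⟩
    · rintro ⟨rfl, rfl⟩
      exact ⟨((e, f), (0, f)), by simp⟩
  · ext ⟨⟨⟨e₁, f₁⟩, ⟨e₂, f₂⟩⟩, ⟨⟨g₁, h₁⟩, ⟨g₂, h₂⟩⟩⟩
    simp only [relComp, muRel', deltaRel', Set.mem_ofPred_eq]
    constructor
    · rintro ⟨⟨e, f⟩, ⟨hx, hf₁, hf₂⟩, hz, hf₃, hf₄⟩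
      refine ⟨(g₁, h₁), (e₁ - g₁, f₁), ⟨?_, ?_, ?_⟩, ⟨?_, ?_, ?_⟩, rfl⟩ <;> grind
    · rintro ⟨⟨a, c⟩, ⟨b, d⟩, ⟨he, hf₁, hf₂⟩, ⟨hg, hf₃, hf₄⟩, hz⟩
      obtain ⟨rfl, rfl⟩ := Prod.mk.inj hz
      refine ⟨(e₁ + e₂, f₁), ⟨rfl, rfl, ?_⟩, ?_, ?_, ?_⟩ <;> grind
end

section
/- Let d₂ be the corelation from Fin 2 to Fin 4 given by the smallest equivalence relation on Fin 2 ⊕ Fin 4 containing the pairs (inl 0, inr 0), (inr 1, inr 2) and (inl 1, inr 3), and let m₂ be the corelation from Fin 4 to Fin 2 given by the smallest equivalence relation on Fin 4 ⊕ Fin 2 containing (inl 0, inr 0), (inl 1, inl 2) and (inl 3, inr 1). Then the composite corelation m₂∘d₂ is the identity corelation on Fin 2, namely the smallest equivalence relation on Fin 2 ⊕ Fin 2 containing (inl 0, inr 0) and (inl 1, inr 1). (This is the special law for the series Frobenius structure on the object 2 of the category of corelations.) -/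
open Relation

/-- The composite of a corelation `r` on `X ⊕ Y` and a corelation `s` on `Y ⊕ Z`:
the equivalence relation on `X ⊕ Z` relating `p` and `q` iff, under the evident
inclusions into `X ⊕ (Y ⊕ Z)`, they are related by the equivalence relation generated
by all pairs related by `r` together with all pairs related by `s`. -/
def corelComp {X Y Z : Type*} (r : Setoid (X ⊕ Y)) (s : Setoid (Y ⊕ Z)) :
    Setoid (X ⊕ Z) :=
  Setoid.mk
    (fun p q =>
      EqvGen
        (fun a b =>
          (∃ a' b', r.r a' b' ∧ a = Sum.map id Sum.inl a' ∧ b = Sum.map id Sum.inl b') ∨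
          (∃ a' b', s.r a' b' ∧ a = Sum.inr a' ∧ b = Sum.inr b'))
        (Sum.map id Sum.inr p) (Sum.map id Sum.inr q))
    ⟨fun _ => EqvGen.refl _, fun h => EqvGen.symm _ _ h, fun h₁ h₂ => EqvGen.trans _ _ _ h₁ h₂⟩

/-- The corelation `d₂ : 2 → 4`, the comultiplication of the series Frobenius structure. -/
def d₂ : Setoid (Fin 2 ⊕ Fin 4) :=
  EqvGen.setoid (fun a b =>
    (a = Sum.inl 0 ∧ b = Sum.inr 0) ∨ (a = Sum.inr 1 ∧ b = Sum.inr 2) ∨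
    (a = Sum.inl 1 ∧ b = Sum.inr 3))

/-- The corelation `m₂ : 4 → 2`, the multiplication of the series Frobenius structure. -/
def m₂ : Setoid (Fin 4 ⊕ Fin 2) :=
  EqvGen.setoid (fun a b =>
    (a = Sum.inl 0 ∧ b = Sum.inr 0) ∨ (a = Sum.inl 1 ∧ b = Sum.inl 2) ∨
    (a = Sum.inl 3 ∧ b = Sum.inr 1))

/-- A function that is constant along a relation is constant along the equivalence relation it
generates. -/
theorem eq_of_eqvGen {α β : Type*} {r : α → α → Prop} (f : α → β)
    (hf : ∀ a b, r a b → f a = f b) {a b : α} (h : EqvGen r a b) : f a = f b := by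
  induction h with
  | rel a b h => exact hf a b h
  | refl a => rfl
  | symm a b _ ih => exact ih.symm
  | trans a b c _ _ ih₁ ih₂ => exact ih₁.trans ih₂

/-- A function constant on the classes of both corelations is constant on the classes of their
composite. -/
theorem eq_of_corelComp {X Y Z β : Type*} {r : Setoid (X ⊕ Y)} {s : Setoid (Y ⊕ Z)}
    (f : X → β) (g : Y → β) (k : Z → β)
    (hr : ∀ a b, r.r a b → Sum.elim f g a = Sum.elim f g b)
    (hs : ∀ a b, s.r a b → Sum.elim g k a = Sum.elim g k b)
    {p q : X ⊕ Z} (h : (corelComp r s).r p q) : Sum.elim f k p = Sum.elim f k q := by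
  have key := eq_of_eqvGen (Sum.elim f (Sum.elim g k)) ?_ h
  · cases p <;> cases q <;> exact key
  · rintro _ _ (⟨a, b, hab, rfl, rfl⟩ | ⟨a, b, hab, rfl, rfl⟩)
    · have := hr a b hab
      cases a <;> cases b <;> exact this
    · exact hs a b hab

/-- In a composite corelation, `x` and `z` are related as soon as both are related to a common
`y`. -/
theorem corelComp_inl_inr {X Y Z : Type*} {r : Setoid (X ⊕ Y)} {s : Setoid (Y ⊕ Z)}
    {x : X} {y : Y} {z : Z} (hr : r.r (Sum.inl x) (Sum.inr y)) (hs : s.r (Sum.inl y) (Sum.inr z)) :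
    (corelComp r s).r (Sum.inl x) (Sum.inr z) :=
  EqvGen.trans _ (Sum.inr (Sum.inl y)) _ (EqvGen.rel _ _ (Or.inl ⟨_, _, hr, rfl, rfl⟩))
    (EqvGen.rel _ _ (Or.inr ⟨_, _, hs, rfl, rfl⟩))

/-- The smallest equivalence relation on `Fin 2 ⊕ Fin 2` identifying the two copies of `Fin 2`
relates elements with the same underlying index. -/
theorem eqvGen_of_elim_eq {p q : Fin 2 ⊕ Fin 2}
    (h : Sum.elim id id p = Sum.elim id id q) :
    EqvGen (fun a b : Fin 2 ⊕ Fin 2 =>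
      (a = Sum.inl 0 ∧ b = Sum.inr 0) ∨ (a = Sum.inl 1 ∧ b = Sum.inr 1)) p q := by
  have key (i : Fin 2) : EqvGen (fun a b : Fin 2 ⊕ Fin 2 =>
      (a = Sum.inl 0 ∧ b = Sum.inr 0) ∨ (a = Sum.inl 1 ∧ b = Sum.inr 1))
      (Sum.inl i) (Sum.inr i) := by
    apply EqvGen.rel
    fin_cases i <;> simp
  rcases p with i | i <;> rcases q with j | j <;> obtain rfl : i = j := h
  · exact EqvGen.refl _
  · exact key i
  · exact EqvGen.symm _ _ (key i)
  · exact EqvGen.refl _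

/-- The special law for the series Frobenius structure on the object
`2` of the category of corelations: `m₂ ∘ d₂` is the identity corelation on `2`. -/
theorem special_law_corelations :
    corelComp d₂ m₂ =
      EqvGen.setoid (fun a b : Fin 2 ⊕ Fin 2 =>
        (a = Sum.inl 0 ∧ b = Sum.inr 0) ∨ (a = Sum.inl 1 ∧ b = Sum.inr 1)) := by
  ext p q
  constructor
  · intro h
    refine eqvGen_of_elim_eq (Fin.castSucc_injective 2 ?_)
    have key := eq_of_corelComp (Fin.castSucc : Fin 2 → Fin 3) ![0, 2, 2, 1] Fin.castSucc ?_ ?_ h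
    · cases p <;> cases q <;> exact key
    · refine fun a b => eq_of_eqvGen _ ?_
      rintro _ _ (⟨rfl, rfl⟩ | ⟨rfl, rfl⟩ | ⟨rfl, rfl⟩) <;> rfl
    · refine fun a b => eq_of_eqvGen _ ?_
      rintro _ _ (⟨rfl, rfl⟩ | ⟨rfl, rfl⟩ | ⟨rfl, rfl⟩) <;> rfl
  · intro h
    refine (Setoid.eqvGen_le (s := corelComp d₂ m₂) ?_) h
    rintro _ _ (⟨rfl, rfl⟩ | ⟨rfl, rfl⟩)
    · exact corelComp_inl_inr (y := 0) (EqvGen.rel _ _ (by simp)) (EqvGen.rel _ _ (by simp))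
    · exact corelComp_inl_inr (y := 3) (EqvGen.rel _ _ (by simp)) (EqvGen.rel _ _ (by simp))
end

section
/- Let m₂ be the corelation from Fin 4 to Fin 2 given by the smallest equivalence relation on Fin 4 ⊕ Fin 2 containing (inl 0, inr 0), (inl 1, inl 2) and (inl 3, inr 1); let d₂ be the corelation from Fin 2 to Fin 4 given by the smallest equivalence relation on Fin 2 ⊕ Fin 4 containing (inl 0, inr 0), (inr 1, inr 2) and (inl 1, inr 3); let μ₂ be the corelation from Fin 4 to Fin 2 given by the smallest equivalence relation on Fin 4 ⊕ Fin 2 containing (inl 0, inr 0), (inl 2, inr 0), (inl 1, inr 1) and (inl 3, inr 1); and let δ₂ be the corelation from Fin 2 to Fin 4 given by the smallest equivalence relation on Fin 2 ⊕ Fin 4 containing (inl 0, inr 0), (inl 0, inr 2), (inl 1, inr 1) and (inl 1, inr 3). Then the composite corelations m₂∘δ₂ and μ₂∘d₂ are equal; indeed both equal the indiscrete equivalence relation on Fin 2 ⊕ Fin 2 that relates all elements. (This is the identity m₂∘δ₂ = μ₂∘d₂ relating the series and parallel structures on the object 2 of the category of corelations.) -/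
open Relation

/-- The corelation `μ₂ : 4 → 2` (parallel multiplication). -/
def μ₂ : Setoid (Fin 4 ⊕ Fin 2) :=
  EqvGen.setoid (fun a b =>
    (a = Sum.inl 0 ∧ b = Sum.inr 0) ∨ (a = Sum.inl 2 ∧ b = Sum.inr 0) ∨
    (a = Sum.inl 1 ∧ b = Sum.inr 1) ∨ (a = Sum.inl 3 ∧ b = Sum.inr 1))

/-- The corelation `δ₂ : 2 → 4` (parallel comultiplication). -/
def δ₂ : Setoid (Fin 2 ⊕ Fin 4) :=
  EqvGen.setoid (fun a b =>
    (a = Sum.inl 0 ∧ b = Sum.inr 0) ∨ (a = Sum.inl 0 ∧ b = Sum.inr 2) ∨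
    (a = Sum.inl 1 ∧ b = Sum.inr 1) ∨ (a = Sum.inl 1 ∧ b = Sum.inr 3))

/-- To relate two points in a composite corelation, it suffices to relate them in every
equivalence relation on `X ⊕ (Y ⊕ Z)` which contains both factors. -/
theorem corelComp_rel_of_forall {X Y Z : Type*} {r : Setoid (X ⊕ Y)} {s : Setoid (Y ⊕ Z)}
    {p q : X ⊕ Z}
    (h : ∀ t : Setoid (X ⊕ (Y ⊕ Z)), r ≤ t.comap (Sum.map id Sum.inl) → s ≤ t.comap Sum.inr →
      t (Sum.map id Sum.inr p) (Sum.map id Sum.inr q)) :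
    corelComp r s p q :=
  h (EqvGen.setoid _)
    (fun a b hab => EqvGen.rel _ _ (Or.inl ⟨a, b, hab, rfl, rfl⟩))
    (fun a b hab => EqvGen.rel _ _ (Or.inr ⟨a, b, hab, rfl, rfl⟩))

/-- An equivalence relation on `Fin 2 ⊕ Fin 2` under which `inl 0` is related to the other
three points is indiscrete. -/
theorem Setoid.eq_top_of_rel_inl_zero {t : Setoid (Fin 2 ⊕ Fin 2)}
    (h₁ : t (Sum.inl 0) (Sum.inl 1)) (h₂ : t (Sum.inl 0) (Sum.inr 0))
    (h₃ : t (Sum.inl 0) (Sum.inr 1)) : t = ⊤ := by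
  have h : ∀ p, t (Sum.inl 0) p := by
    rintro (i | i) <;> fin_cases i
    exacts [t.refl _, h₁, h₂, h₃]
  exact Setoid.eq_top_iff.2 fun p q => t.trans (t.symm (h p)) (h q)

theorem corelComp_δ₂_m₂ : corelComp δ₂ m₂ = ⊤ := by
  have key (t : Setoid (Fin 2 ⊕ (Fin 4 ⊕ Fin 2))) (hr : δ₂ ≤ t.comap (Sum.map id Sum.inl))
      (hs : m₂ ≤ t.comap Sum.inr) :
      t (Sum.inl 0) (Sum.inl 1) ∧ t (Sum.inl 0) (Sum.inr (Sum.inr 0)) ∧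
        t (Sum.inl 0) (Sum.inr (Sum.inr 1)) := by
    have h₁ : t (Sum.inl 0) (Sum.inr (Sum.inl 0)) :=
      @hr (Sum.inl 0) (Sum.inr 0) (EqvGen.rel _ _ (by simp))
    have h₂ : t (Sum.inl 0) (Sum.inr (Sum.inl 2)) :=
      @hr (Sum.inl 0) (Sum.inr 2) (EqvGen.rel _ _ (by simp))
    have h₃ : t (Sum.inl 1) (Sum.inr (Sum.inl 1)) :=
      @hr (Sum.inl 1) (Sum.inr 1) (EqvGen.rel _ _ (by simp))
    have h₄ : t (Sum.inl 1) (Sum.inr (Sum.inl 3)) :=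
      @hr (Sum.inl 1) (Sum.inr 3) (EqvGen.rel _ _ (by simp))
    have h₅ : t (Sum.inr (Sum.inl 0)) (Sum.inr (Sum.inr 0)) :=
      @hs (Sum.inl 0) (Sum.inr 0) (EqvGen.rel _ _ (by simp))
    have h₆ : t (Sum.inr (Sum.inl 1)) (Sum.inr (Sum.inl 2)) :=
      @hs (Sum.inl 1) (Sum.inl 2) (EqvGen.rel _ _ (by simp))
    have h₇ : t (Sum.inr (Sum.inl 3)) (Sum.inr (Sum.inr 1)) :=
      @hs (Sum.inl 3) (Sum.inr 1) (EqvGen.rel _ _ (by simp))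
    have h : t (Sum.inl 0) (Sum.inl 1) := t.trans h₂ (t.trans (t.symm h₆) (t.symm h₃))
    exact ⟨h, t.trans h₁ h₅, t.trans h (t.trans h₄ h₇)⟩
  exact Setoid.eq_top_of_rel_inl_zero
    (corelComp_rel_of_forall fun t hr hs => (key t hr hs).1)
    (corelComp_rel_of_forall fun t hr hs => (key t hr hs).2.1)
    (corelComp_rel_of_forall fun t hr hs => (key t hr hs).2.2)

theorem corelComp_d₂_μ₂ : corelComp d₂ μ₂ = ⊤ := by
  have key (t : Setoid (Fin 2 ⊕ (Fin 4 ⊕ Fin 2))) (hr : d₂ ≤ t.comap (Sum.map id Sum.inl))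
      (hs : μ₂ ≤ t.comap Sum.inr) :
      t (Sum.inl 0) (Sum.inl 1) ∧ t (Sum.inl 0) (Sum.inr (Sum.inr 0)) ∧
        t (Sum.inl 0) (Sum.inr (Sum.inr 1)) := by
    have h₁ : t (Sum.inl 0) (Sum.inr (Sum.inl 0)) :=
      @hr (Sum.inl 0) (Sum.inr 0) (EqvGen.rel _ _ (by simp))
    have h₂ : t (Sum.inr (Sum.inl 1)) (Sum.inr (Sum.inl 2)) :=
      @hr (Sum.inr 1) (Sum.inr 2) (EqvGen.rel _ _ (by simp))
    have h₃ : t (Sum.inl 1) (Sum.inr (Sum.inl 3)) :=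
      @hr (Sum.inl 1) (Sum.inr 3) (EqvGen.rel _ _ (by simp))
    have h₄ : t (Sum.inr (Sum.inl 0)) (Sum.inr (Sum.inr 0)) :=
      @hs (Sum.inl 0) (Sum.inr 0) (EqvGen.rel _ _ (by simp))
    have h₅ : t (Sum.inr (Sum.inl 2)) (Sum.inr (Sum.inr 0)) :=
      @hs (Sum.inl 2) (Sum.inr 0) (EqvGen.rel _ _ (by simp))
    have h₆ : t (Sum.inr (Sum.inl 1)) (Sum.inr (Sum.inr 1)) :=
      @hs (Sum.inl 1) (Sum.inr 1) (EqvGen.rel _ _ (by simp))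
    have h₇ : t (Sum.inr (Sum.inl 3)) (Sum.inr (Sum.inr 1)) :=
      @hs (Sum.inl 3) (Sum.inr 1) (EqvGen.rel _ _ (by simp))
    have h₈ : t (Sum.inl 0) (Sum.inr (Sum.inr 0)) := t.trans h₁ h₄
    have h₉ : t (Sum.inl 0) (Sum.inr (Sum.inr 1)) :=
      t.trans h₈ (t.trans (t.symm h₅) (t.trans (t.symm h₂) h₆))
    exact ⟨t.trans h₉ (t.symm (t.trans h₃ h₇)), h₈, h₉⟩
  exact Setoid.eq_top_of_rel_inl_zero
    (corelComp_rel_of_forall fun t hr hs => (key t hr hs).1)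
    (corelComp_rel_of_forall fun t hr hs => (key t hr hs).2.1)
    (corelComp_rel_of_forall fun t hr hs => (key t hr hs).2.2)

/-- `m₂ ∘ δ₂ = μ₂ ∘ d₂`, and both equal the indiscrete equivalence
relation on `Fin 2 ⊕ Fin 2` relating all elements. -/
theorem series_parallel_composite :
    corelComp δ₂ m₂ = corelComp d₂ μ₂ ∧
    corelComp δ₂ m₂ =
      Setoid.mk (fun _ _ => True)
        ⟨fun _ => trivial, fun _ => trivial, fun _ _ => trivial⟩ := by
  exact ⟨corelComp_δ₂_m₂.trans corelComp_d₂_μ₂.symm, corelComp_δ₂_m₂⟩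
end

section
/- Let k be a field with the symplectic form ω on k² given by ω((φ,I),(φ',I')) = φ·I' − φ'·I, and equip (k²)⁴ × (k²)² with the bilinear form Ω sending ((p₁,p₂,p₃,p₄,q₁,q₂),(p₁',p₂',p₃',p₄',q₁',q₂')) to −ω(p₁,p₁') − ω(p₂,p₂') − ω(p₃,p₃') − ω(p₄,p₄') + ω(q₁,q₁') + ω(q₂,q₂'). Then both of the following subspaces are Lagrangian (isotropic of dimension 6 in the 12-dimensional ambient space): (1) {(φ₁,i₁,φ₂,i₂,φ₃,i₃,φ₄,i₄,φ₅,i₅,φ₆,i₆) : φ₁ = φ₅, i₁ = i₅, φ₄ = φ₆, i₄ = i₆, φ₂ = φ₃, i₂ + i₃ = 0}, the potential–current behavior of a bond-graph 1-junction realized as a circuit; and (2) {(φ₁,i₁,φ₂,i₂,φ₃,i₃,φ₄,i₄,φ₅,i₅,φ₆,i₆) : φ₁ = φ₃ = φ₅, φ₂ = φ₄ = φ₆, i₁ + i₃ = i₅, i₂ + i₄ = i₆}, the potential–current behavior of a bond-graph 0-junction realized as a circuit. -/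
open Module

/-- The ambient space `(k²)⁴ × (k²)²`: six copies of `k²`. -/
abbrev Amb (k : Type*) := (k × k) × (k × k) × (k × k) × (k × k) × (k × k) × (k × k)

/-- The form `Ω = −ω ⊕ −ω ⊕ −ω ⊕ −ω ⊕ ω ⊕ ω` on `(k²)⁴ × (k²)²`. -/
def bigForm (k : Type*) [Field k] : Amb k → Amb k → k :=
  fun p q =>
    -sympForm k p.1 q.1 - sympForm k p.2.1 q.2.1 - sympForm k p.2.2.1 q.2.2.1 -
      sympForm k p.2.2.2.1 q.2.2.2.1 + sympForm k p.2.2.2.2.1 q.2.2.2.2.1 +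
      sympForm k p.2.2.2.2.2 q.2.2.2.2.2

/-- The parametrization of the 1-junction behavior by the values on terminals 1, 2 and 4. -/
def oneJunctionMap (k : Type*) [Field k] : (k × k) × (k × k) × (k × k) →ₗ[k] Amb k where
  toFun v := (v.1, v.2.1, (v.2.1.1, -v.2.1.2), v.2.2, v.1, v.2.2)
  map_add' v w := by simp [add_comm]
  map_smul' c v := by simp

/-- The parametrization of the 0-junction behavior by the values on terminals 1 and 2 and the
currents on terminals 3 and 4. -/
def zeroJunctionMap (k : Type*) [Field k] : (k × k) × (k × k) × (k × k) →ₗ[k] Amb k where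
  toFun v := (v.1, v.2.1, (v.1.1, v.2.2.1), (v.2.1.1, v.2.2.2),
    (v.1.1, v.1.2 + v.2.2.1), (v.2.1.1, v.2.1.2 + v.2.2.2))
  map_add' v w := by simp [add_add_add_comm]
  map_smul' c v := by simp [mul_add]

theorem oneJunctionMap_injective (k : Type*) [Field k] :
    Function.Injective (oneJunctionMap k) := by
  rintro ⟨a, b, c⟩ ⟨a', b', c'⟩ h
  simp only [oneJunctionMap, LinearMap.coe_mk, AddHom.coe_mk, Prod.mk.injEq] at h ⊢
  tauto

theorem zeroJunctionMap_injective (k : Type*) [Field k] :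
    Function.Injective (zeroJunctionMap k) := by
  rintro ⟨a, b, c, d⟩ ⟨a', b', c', d'⟩ h
  simp only [zeroJunctionMap, LinearMap.coe_mk, AddHom.coe_mk, Prod.mk.injEq] at h ⊢
  tauto

/-- The potential–current behaviors of a bond-graph 1-junction and of a
0-junction, realized as circuits of perfectly conductive wires, are Lagrangian
subspaces (isotropic of dimension 6 in the 12-dimensional ambient space). -/
theorem junction_behaviors_lagrangian (k : Type*) [Field k] :
    finrank k (Amb k) = 12 ∧
    -- (1) the 1-junction: φ₁ = φ₅, i₁ = i₅, φ₄ = φ₆, i₄ = i₆, φ₂ = φ₃, i₂ + i₃ = 0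
    (∃ L : Submodule k (Amb k),
      (L : Set (Amb k)) =
        {p | p.1.1 = p.2.2.2.2.1.1 ∧ p.1.2 = p.2.2.2.2.1.2 ∧
             p.2.2.2.1.1 = p.2.2.2.2.2.1 ∧ p.2.2.2.1.2 = p.2.2.2.2.2.2 ∧
             p.2.1.1 = p.2.2.1.1 ∧ p.2.1.2 + p.2.2.1.2 = 0} ∧
      (∀ x ∈ L, ∀ y ∈ L, bigForm k x y = 0) ∧
      finrank k L = 6) ∧
    -- (2) the 0-junction: φ₁ = φ₃ = φ₅, φ₂ = φ₄ = φ₆, i₁ + i₃ = i₅, i₂ + i₄ = i₆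
    (∃ L : Submodule k (Amb k),
      (L : Set (Amb k)) =
        {p | p.1.1 = p.2.2.1.1 ∧ p.2.2.1.1 = p.2.2.2.2.1.1 ∧
             p.2.1.1 = p.2.2.2.1.1 ∧ p.2.2.2.1.1 = p.2.2.2.2.2.1 ∧
             p.1.2 + p.2.2.1.2 = p.2.2.2.2.1.2 ∧
             p.2.1.2 + p.2.2.2.1.2 = p.2.2.2.2.2.2} ∧
      (∀ x ∈ L, ∀ y ∈ L, bigForm k x y = 0) ∧
      finrank k L = 6) := by
  refine ⟨by simp, ⟨LinearMap.range (oneJunctionMap k), ?_, ?_, ?_⟩,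
    ⟨LinearMap.range (zeroJunctionMap k), ?_, ?_, ?_⟩⟩
  · ext ⟨p₁, ⟨φ₂, i₂⟩, ⟨φ₃, i₃⟩, p₄, p₅, p₆⟩
    constructor
    · rintro ⟨v, hv⟩
      simp only [oneJunctionMap, LinearMap.coe_mk, AddHom.coe_mk, Prod.mk.injEq] at hv
      obtain ⟨rfl, hv₂, ⟨rfl, rfl⟩, rfl, rfl, rfl⟩ := hv
      simp [hv₂]
    · rintro ⟨h₁, h₂, h₃, h₄, h₅, h₆⟩
      refine ⟨(p₁, (φ₂, i₂), p₄), ?_⟩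
      simp only [oneJunctionMap, LinearMap.coe_mk, AddHom.coe_mk, Prod.mk.injEq, true_and]
      exact ⟨⟨h₅, neg_eq_of_add_eq_zero_right h₆⟩, Prod.ext h₁ h₂, Prod.ext h₃ h₄⟩
  · rintro _ ⟨v, rfl⟩ _ ⟨w, rfl⟩
    simp only [bigForm, sympForm, oneJunctionMap, LinearMap.coe_mk, AddHom.coe_mk]
    ring
  · rw [LinearMap.finrank_range_of_inj (oneJunctionMap_injective k)]
    simp
  · ext ⟨⟨φ₁, i₁⟩, ⟨φ₂, i₂⟩, ⟨φ₃, i₃⟩, ⟨φ₄, i₄⟩, ⟨φ₅, i₅⟩, ⟨φ₆, i₆⟩⟩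
    constructor
    · rintro ⟨⟨⟨φ, i⟩, ⟨ψ, j⟩, l, m⟩, hv⟩
      simp only [zeroJunctionMap, LinearMap.coe_mk, AddHom.coe_mk, Prod.mk.injEq] at hv
      obtain ⟨⟨rfl, rfl⟩, ⟨rfl, rfl⟩, ⟨rfl, rfl⟩, ⟨rfl, rfl⟩, ⟨rfl, rfl⟩, rfl, rfl⟩ := hv
      simp
    · rintro ⟨h₁, h₂, h₃, h₄, h₅, h₆⟩
      refine ⟨((φ₁, i₁), (φ₂, i₂), i₃, i₄), ?_⟩
      simp only [zeroJunctionMap, LinearMap.coe_mk, AddHom.coe_mk, Prod.mk.injEq,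
        true_and, and_true]
      exact ⟨h₁, h₃, ⟨h₁.trans h₂, h₅⟩, h₃.trans h₄, h₆⟩
  · rintro _ ⟨v, rfl⟩ _ ⟨w, rfl⟩
    simp only [bigForm, sympForm, zeroJunctionMap, LinearMap.coe_mk, AddHom.coe_mk]
    ring
  · rw [LinearMap.finrank_range_of_inj (zeroJunctionMap_injective k)]
    simp
end
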